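/- For every integer n ≥ 1 and every t > 0, the product of modified Bessel functions satisfies K_n(t)·I_n(t) ≤ 1/(2n). -/

import Mathlib

open MeasureTheory Real intervalIntegral

/-- Modified Bessel function of the first kind of integer order `n`:
`I_n(t) = (1/π) ∫_0^π exp(t cos α) cos(n α) dα`. -/
noncomputable def besselI (n : ℤ) (t : ℝ) : ℝ :=
  (1 / Real.pi) * ∫ α in (0:ℝ)..Real.pi, Real.exp (t * Real.cos α) * Real.cos ((n : ℝ) * α)

/-- Modified Bessel function of the second kind of integer order `n`:
`K_n(t) = ∫_0^∞ exp(−t cosh α) cosh(n α) dα`. -/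
noncomputable def besselK (n : ℤ) (t : ℝ) : ℝ :=
  ∫ α in Set.Ioi (0:ℝ), Real.exp (-t * Real.cosh α) * Real.cosh ((n : ℝ) * α)

open Filter Topology

lemma bK_bound (m : ℝ) {c x : ℝ} (hc : 0 < c) (hx : 0 ≤ x) :
    Real.exp (-c * Real.cosh x) * Real.cosh (m * x) ≤
      Real.exp ((|m| + 1) ^ 2 / c) * Real.exp (-x) := by
  have h1 : x ^ 2 / 4 ≤ Real.cosh x := by
    rw [Real.cosh_eq]
    have := Real.quadratic_le_exp_of_nonneg hx
    have := Real.exp_pos (-x)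
    nlinarith
  have h2 : Real.cosh (m * x) ≤ Real.exp (|m| * x) := by
    rw [← Real.cosh_abs, abs_mul, abs_of_nonneg hx, Real.cosh_eq]
    have : Real.exp (-(|m| * x)) ≤ Real.exp (|m| * x) := by
      apply Real.exp_le_exp.2
      have : 0 ≤ |m| * x := by positivity
      linarith
    linarith
  calc _ ≤ Real.exp (-c * Real.cosh x) * Real.exp (|m| * x) := by gcongr
    _ = Real.exp (-c * Real.cosh x + |m| * x) := by rw [Real.exp_add]
    _ ≤ Real.exp ((|m| + 1) ^ 2 / c + -x) := by
      apply Real.exp_le_exp.2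
      have h3 : c * (x ^ 2 / 4) ≤ c * Real.cosh x := by gcongr
      have h4 : 0 ≤ (c * x / 2 - (|m| + 1)) ^ 2 / c := by positivity
      have h5 : (c * x / 2 - (|m| + 1)) ^ 2 / c
          = c * (x ^ 2 / 4) - (|m| + 1) * x + (|m| + 1) ^ 2 / c := by
        field_simp; ring
      linarith
    _ = _ := by rw [Real.exp_add]

lemma bK_int (m : ℝ) {c : ℝ} (hc : 0 < c) :
    IntegrableOn (fun x : ℝ => Real.exp (-c * Real.cosh x) * Real.cosh (m * x)) (Set.Ioi 0) := by
  refine Integrable.mono' ((integrableOn_exp_neg_Ioi 0).const_mul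
    (Real.exp ((|m| + 1) ^ 2 / c))) ?_ ?_
  · exact (by fun_prop : Continuous fun x : ℝ =>
      Real.exp (-c * Real.cosh x) * Real.cosh (m * x)).aestronglyMeasurable
  · refine (ae_restrict_mem measurableSet_Ioi).mono fun x hx => ?_
    rw [Real.norm_of_nonneg (by positivity)]
    exact bK_bound m hc (le_of_lt hx)

lemma bK_nonneg (n : ℤ) (t : ℝ) : 0 ≤ besselK n t := by
  unfold besselK
  exact integral_nonneg fun x => by positivity

lemma bK_rec (n : ℤ) {t : ℝ} (ht : 0 < t) :
    t * (besselK (n + 1) t - besselK (n - 1) t) = 2 * n * besselK n t := by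
  have hi := bK_int n ht
  have hi1 := bK_int ((n + 1 : ℤ) : ℝ) ht
  have hi2 := bK_int ((n - 1 : ℤ) : ℝ) ht
  have hlim : Tendsto (fun x : ℝ => Real.exp (-t * Real.cosh x) * Real.sinh (n * x)) atTop (𝓝 0) := by
    have h0 : Tendsto (fun x : ℝ => Real.exp ((|(n:ℝ)| + 1) ^ 2 / t) * Real.exp (-x)) atTop (𝓝 0) := by
      simpa using (Real.tendsto_exp_neg_atTop_nhds_zero).const_mul (Real.exp ((|(n:ℝ)| + 1) ^ 2 / t))
    refine squeeze_zero_norm' ?_ h0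
    filter_upwards [eventually_ge_atTop 0] with x hx
    refine le_trans ?_ (bK_bound n ht hx)
    rw [norm_mul, Real.norm_of_nonneg (Real.exp_pos _).le]
    gcongr
    rw [Real.norm_eq_abs, abs_le, Real.cosh_eq, Real.sinh_eq]
    constructor <;> linarith [Real.exp_pos (n * x), Real.exp_pos (-(n * x))]
  have key := integral_Ioi_of_hasDerivAt_of_tendsto' (a := 0)
    (f := fun x : ℝ => Real.exp (-t * Real.cosh x) * Real.sinh (n * x))
    (f' := fun x : ℝ => n * (Real.exp (-t * Real.cosh x) * Real.cosh (n * x))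
      - t / 2 * (Real.exp (-t * Real.cosh x) * Real.cosh ((n + 1 : ℤ) * x)
        - Real.exp (-t * Real.cosh x) * Real.cosh ((n - 1 : ℤ) * x)))
    (fun x _ => by
      have h1 : HasDerivAt (fun x : ℝ => Real.exp (-t * Real.cosh x))
          (Real.exp (-t * Real.cosh x) * (-t * Real.sinh x)) x :=
        ((Real.hasDerivAt_cosh x).const_mul (-t)).exp
      have h2 : HasDerivAt (fun x : ℝ => Real.sinh (n * x))
          (Real.cosh (n * x) * (n * 1)) x :=
        ((hasDerivAt_id x).const_mul (n : ℝ)).sinh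
      refine (h1.mul h2).congr_deriv ?_
      push_cast
      rw [add_mul, sub_mul, one_mul, Real.cosh_add, Real.cosh_sub]
      ring)
    ((hi.const_mul _).sub ((hi1.sub hi2).const_mul _)) hlim
  have hi3 : IntegrableOn (fun x : ℝ => t / 2 *
      (Real.exp (-t * Real.cosh x) * Real.cosh ((n + 1 : ℤ) * x)
        - Real.exp (-t * Real.cosh x) * Real.cosh ((n - 1 : ℤ) * x))) (Set.Ioi 0) :=
    (hi1.sub hi2).const_mul _
  rw [MeasureTheory.integral_sub (hi.const_mul _) hi3, MeasureTheory.integral_const_mul,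
    MeasureTheory.integral_const_mul, MeasureTheory.integral_sub hi1 hi2] at key
  simp only [mul_zero, Real.sinh_zero, sub_zero] at key
  unfold besselK
  linarith

lemma bK_deriv (n : ℤ) {t : ℝ} (ht : 0 < t) :
    HasDerivAt (besselK n) (-(besselK (n + 1) t + besselK (n - 1) t) / 2) t := by
  have ht2 : 0 < t / 2 := by positivity
  have hi1 := bK_int ((n + 1 : ℤ) : ℝ) ht
  have hi2 := bK_int ((n - 1 : ℤ) : ℝ) ht
  have hid (x : ℝ) : Real.cosh x * Real.cosh (n * x) =
      (Real.cosh ((n + 1 : ℤ) * x) + Real.cosh ((n - 1 : ℤ) * x)) / 2 := by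
    push_cast
    rw [add_mul, sub_mul, one_mul, Real.cosh_add, Real.cosh_sub]
    ring
  have key := (hasDerivAt_integral_of_dominated_loc_of_deriv_le
    (μ := volume.restrict (Set.Ioi (0:ℝ))) (x₀ := t) (s := Set.Ioi (t / 2))
    (F := fun t x => Real.exp (-t * Real.cosh x) * Real.cosh (n * x))
    (F' := fun t x => Real.exp (-t * Real.cosh x) * (- Real.cosh x) * Real.cosh (n * x))
    (bound := fun x => (Real.exp (-(t / 2) * Real.cosh x) * Real.cosh ((n + 1 : ℤ) * x)
      + Real.exp (-(t / 2) * Real.cosh x) * Real.cosh ((n - 1 : ℤ) * x)) / 2)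
    (Ioi_mem_nhds (by linarith))
    (Eventually.of_forall fun s => (by fun_prop : Continuous fun x : ℝ =>
      Real.exp (-s * Real.cosh x) * Real.cosh (n * x)).aestronglyMeasurable)
    (bK_int n ht)
    (by fun_prop : Continuous fun x : ℝ =>
      Real.exp (-t * Real.cosh x) * (- Real.cosh x) * Real.cosh (n * x)).aestronglyMeasurable
    (ae_of_all _ fun x s hs => by
      rw [← mul_add, mul_div_assoc, ← hid, norm_mul, norm_mul, norm_neg,
        Real.norm_of_nonneg (Real.exp_pos _).le, Real.norm_of_nonneg (Real.cosh_pos _).le,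
        Real.norm_of_nonneg (Real.cosh_pos _).le, mul_assoc]
      have := Real.cosh_pos x
      have := Real.cosh_pos (n * x)
      have hs' : t / 2 ≤ s := le_of_lt hs
      gcongr)
    (((bK_int _ ht2).add (bK_int _ ht2)).div_const 2)
    (ae_of_all _ fun x s hs => by
      have h := (((hasDerivAt_id s).neg.mul_const (Real.cosh x)).exp).mul_const (Real.cosh (n * x))
      refine h.congr_deriv ?_
      simp)).2
  have e : (-(besselK (n + 1) t + besselK (n - 1) t) / 2) =
      ∫ x in Set.Ioi (0:ℝ), Real.exp (-t * Real.cosh x) * (- Real.cosh x) * Real.cosh (n * x) := by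
    unfold besselK
    rw [← MeasureTheory.integral_add hi1 hi2, ← MeasureTheory.integral_neg,
      ← MeasureTheory.integral_div]
    congr 1
    ext x
    linear_combination Real.exp (-t * Real.cosh x) * hid x
  rw [e]
  exact key

lemma bK1_le {t : ℝ} (ht : 0 < t) : t * besselK 1 t ≤ 1 := by
  have hlim : Tendsto (fun x : ℝ => - Real.exp (-t * Real.sinh x)) atTop (𝓝 0) := by
    rw [← neg_zero]
    refine Tendsto.neg ?_
    refine Real.tendsto_exp_atBot.comp ?_
    refine Tendsto.const_mul_atTop_of_neg (by linarith) ?_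
    refine tendsto_atTop_mono' _ ?_ tendsto_id
    filter_upwards [eventually_ge_atTop 0] with x hx
    exact Real.self_le_sinh_iff.2 hx
  have hd : ∀ x ∈ Set.Ici (0:ℝ), HasDerivAt (fun x : ℝ => - Real.exp (-t * Real.sinh x))
      (t * Real.cosh x * Real.exp (-t * Real.sinh x)) x := fun x _ => by
    refine (((Real.hasDerivAt_sinh x).const_mul (-t)).exp).neg.congr_deriv ?_
    ring
  have hpos : ∀ x ∈ Set.Ioi (0:ℝ), 0 ≤ t * Real.cosh x * Real.exp (-t * Real.sinh x) :=
    fun x _ => by positivity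
  have hint := integrableOn_Ioi_deriv_of_nonneg' hd hpos hlim
  have key := integral_Ioi_of_hasDerivAt_of_tendsto' hd hint hlim
  simp only [Real.sinh_zero, mul_zero, Real.exp_zero, sub_neg_eq_add, zero_add] at key
  rw [← key]
  unfold besselK
  rw [← MeasureTheory.integral_const_mul]
  refine integral_mono ((bK_int _ ht).const_mul t) hint fun x => ?_
  have : Real.exp (-t * Real.cosh x) ≤ Real.exp (-t * Real.sinh x) := by
    apply Real.exp_le_exp.2
    have := Real.sinh_lt_cosh x
    nlinarith
  have := mul_le_mul_of_nonneg_left this (by positivity : 0 ≤ t * Real.cosh x)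
  simp only [Int.cast_one, one_mul]
  linarith

lemma bK0_le {t : ℝ} (ht : 0 < t) : besselK 0 t ≤ besselK 1 t := by
  unfold besselK
  refine integral_mono (bK_int _ ht) (bK_int _ ht) fun x => ?_
  simp only [Int.cast_zero, zero_mul, Real.cosh_zero, Int.cast_one, one_mul]
  have := Real.one_le_cosh x
  gcongr

lemma bI_rec (n : ℤ) (t : ℝ) :
    t * (besselI (n - 1) t - besselI (n + 1) t) = 2 * n * besselI n t := by
  have hi (m : ℤ) : IntervalIntegrable
      (fun x : ℝ => Real.exp (t * Real.cos x) * Real.cos (m * x)) volume 0 Real.pi :=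
    (by fun_prop : Continuous fun x : ℝ =>
      Real.exp (t * Real.cos x) * Real.cos (m * x)).intervalIntegrable _ _
  have key := intervalIntegral.integral_eq_sub_of_hasDerivAt (a := 0) (b := Real.pi)
    (f := fun x : ℝ => Real.exp (t * Real.cos x) * Real.sin (n * x))
    (f' := fun x : ℝ => n * (Real.exp (t * Real.cos x) * Real.cos (n * x))
      - t / 2 * (Real.exp (t * Real.cos x) * Real.cos ((n - 1 : ℤ) * x)
        - Real.exp (t * Real.cos x) * Real.cos ((n + 1 : ℤ) * x)))
    (fun x _ => by
      have h1 : HasDerivAt (fun x : ℝ => Real.exp (t * Real.cos x))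
          (Real.exp (t * Real.cos x) * (t * -Real.sin x)) x :=
        ((Real.hasDerivAt_cos x).const_mul t).exp
      have h2 : HasDerivAt (fun x : ℝ => Real.sin (n * x))
          (Real.cos (n * x) * (n * 1)) x :=
        ((hasDerivAt_id x).const_mul (n : ℝ)).sin
      refine (h1.mul h2).congr_deriv ?_
      push_cast
      rw [add_mul, sub_mul, one_mul, Real.cos_add, Real.cos_sub]
      ring)
    (((hi n).const_mul _).sub (((hi (n-1)).sub (hi (n+1))).const_mul _))
  rw [intervalIntegral.integral_sub ((hi n).const_mul _)
    (((hi (n-1)).sub (hi (n+1))).const_mul _), intervalIntegral.integral_const_mul,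
    intervalIntegral.integral_const_mul, intervalIntegral.integral_sub (hi (n-1)) (hi (n+1))] at key
  simp only [mul_zero, Real.sin_zero, sub_zero, Real.sin_int_mul_pi] at key
  unfold besselI
  linear_combination (-2 / Real.pi) * key

lemma bI_deriv (n : ℤ) (t : ℝ) :
    HasDerivAt (besselI n) ((besselI (n + 1) t + besselI (n - 1) t) / 2) t := by
  have hi (m : ℤ) : IntervalIntegrable
      (fun x : ℝ => Real.exp (t * Real.cos x) * Real.cos (m * x)) volume 0 Real.pi :=
    (by fun_prop : Continuous fun x : ℝ =>
      Real.exp (t * Real.cos x) * Real.cos (m * x)).intervalIntegrable _ _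
  have hid (x : ℝ) : Real.cos x * Real.cos (n * x) =
      (Real.cos ((n + 1 : ℤ) * x) + Real.cos ((n - 1 : ℤ) * x)) / 2 := by
    push_cast
    rw [add_mul, sub_mul, one_mul, Real.cos_add, Real.cos_sub]
    ring
  have key := (intervalIntegral.hasDerivAt_integral_of_dominated_loc_of_deriv_le
    (μ := volume) (a := 0) (b := Real.pi) (x₀ := t) (s := Metric.ball t 1)
    (F := fun t x => Real.exp (t * Real.cos x) * Real.cos (n * x))
    (F' := fun t x => Real.exp (t * Real.cos x) * (Real.cos x) * Real.cos (n * x))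
    (bound := fun x => Real.exp (|t| + 1))
    (Metric.ball_mem_nhds _ one_pos)
    (Eventually.of_forall fun s => (by fun_prop : Continuous fun x : ℝ =>
      Real.exp (s * Real.cos x) * Real.cos (n * x)).aestronglyMeasurable)
    (hi n)
    (by fun_prop : Continuous fun x : ℝ =>
      Real.exp (t * Real.cos x) * (Real.cos x) * Real.cos (n * x)).aestronglyMeasurable
    (ae_of_all _ fun x _ s hs => by
      rw [norm_mul, norm_mul, Real.norm_of_nonneg (Real.exp_pos _).le]
      have h1 := Real.abs_cos_le_one x
      have h2 := Real.abs_cos_le_one (n * x)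
      have h3 : s * Real.cos x ≤ |t| + 1 := by
        have : |s| ≤ |t| + 1 := by
          rw [Metric.mem_ball, Real.dist_eq] at hs
          have := abs_sub_abs_le_abs_sub s t
          linarith
        calc s * Real.cos x ≤ |s * Real.cos x| := le_abs_self _
          _ = |s| * |Real.cos x| := abs_mul _ _
          _ ≤ |s| * 1 := by gcongr
          _ ≤ _ := by linarith
      calc _ ≤ Real.exp (|t| + 1) * 1 * 1 := by
            simp only [Real.norm_eq_abs]
            gcongr
        _ = _ := by ring)
    (intervalIntegrable_const)
    (ae_of_all _ fun x _ s hs => by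
      have h := (((hasDerivAt_id s).mul_const (Real.cos x)).exp).mul_const (Real.cos (n * x))
      refine h.congr_deriv ?_
      simp)).2
  have e : ((besselI (n + 1) t + besselI (n - 1) t) / 2) =
      (1 / Real.pi) * ∫ x in (0:ℝ)..Real.pi,
        Real.exp (t * Real.cos x) * (Real.cos x) * Real.cos (n * x) := by
    unfold besselI
    rw [← mul_add, ← intervalIntegral.integral_add (hi _) (hi _), mul_div_assoc,
      ← intervalIntegral.integral_div]
    congr 2
    ext x
    rw [← mul_add, mul_assoc, hid]
    ring
  rw [e]
  exact key.const_mul _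

lemma cospow_nonneg (k : ℕ) : ∀ n : ℤ,
    0 ≤ ∫ x in (0:ℝ)..Real.pi, Real.cos x ^ k * Real.cos (n * x) := by
  induction k with
  | zero =>
    intro n
    by_cases hn : n = 0
    · subst hn; simp [Real.pi_pos.le]
    · have : (n : ℝ) ≠ 0 := by exact_mod_cast hn
      simp [intervalIntegral.integral_comp_mul_left (fun x => Real.cos x) this, Real.sin_int_mul_pi]
  | succ k ih =>
    intro n
    have hi (m : ℤ) : IntervalIntegrable
        (fun x : ℝ => Real.cos x ^ k * Real.cos (m * x)) volume 0 Real.pi :=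
      (by fun_prop : Continuous fun x : ℝ =>
        Real.cos x ^ k * Real.cos (m * x)).intervalIntegrable _ _
    have e : (fun x : ℝ => Real.cos x ^ (k+1) * Real.cos (n * x)) = fun x : ℝ =>
        (Real.cos x ^ k * Real.cos ((n+1 : ℤ) * x) + Real.cos x ^ k * Real.cos ((n-1 : ℤ) * x)) / 2 := by
      ext x
      push_cast
      rw [add_mul, sub_mul, one_mul, Real.cos_add, Real.cos_sub]
      ring
    rw [e, intervalIntegral.integral_div, intervalIntegral.integral_add (hi _) (hi _)]
    have := ih (n+1)
    have := ih (n-1)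
    linarith

lemma bI_nonneg (n : ℤ) {t : ℝ} (ht : 0 < t) : 0 ≤ besselI n t := by
  unfold besselI
  refine mul_nonneg (by positivity) ?_
  have key := intervalIntegral.hasSum_integral_of_dominated_convergence
    (μ := volume) (a := 0) (b := Real.pi)
    (F := fun (k : ℕ) (x : ℝ) => (t * Real.cos x) ^ k / (k.factorial : ℝ) * Real.cos (n * x))
    (f := fun x => Real.exp (t * Real.cos x) * Real.cos (n * x))
    (fun k _ => t ^ k / (k.factorial : ℝ))
    (fun k => (by fun_prop : Continuous fun x : ℝ =>
      (t * Real.cos x) ^ k / (k.factorial : ℝ) * Real.cos (n * x)).aestronglyMeasurable)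
    (fun k => ae_of_all _ fun x _ => by
      rw [norm_mul, norm_div, norm_pow, norm_mul, Real.norm_of_nonneg ht.le, Real.norm_natCast,
        Real.norm_eq_abs, Real.norm_eq_abs]
      have h1 := Real.abs_cos_le_one x
      have h2 := Real.abs_cos_le_one (n * x)
      calc _ ≤ (t * 1) ^ k / (k.factorial : ℝ) * 1 := by gcongr
        _ = _ := by simp)
    (ae_of_all _ fun x _ => Real.summable_pow_div_factorial t)
    (intervalIntegrable_const)
    (ae_of_all _ fun x _ => by
      refine HasSum.mul_right _ ?_
      rw [Real.exp_eq_exp_ℝ]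
      exact NormedSpace.expSeries_div_hasSum_exp (t * Real.cos x))
  refine key.nonneg fun k => ?_
  have e : (fun x : ℝ => (t * Real.cos x) ^ k / (k.factorial : ℝ) * Real.cos (n * x)) =
      fun x : ℝ => (t ^ k / (k.factorial : ℝ)) * (Real.cos x ^ k * Real.cos (n * x)) := by
    ext x; rw [mul_pow]; ring
  rw [e, intervalIntegral.integral_const_mul]
  exact mul_nonneg (by positivity) (cospow_nonneg k n)

lemma bW_const {s t : ℝ} (hs : 0 < s) (ht : 0 < t) :
    s * (besselI 0 s * besselK 1 s + besselI 1 s * besselK 0 s) =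
    t * (besselI 0 t * besselK 1 t + besselI 1 t * besselK 0 t) := by
  have hd : ∀ x ∈ Set.Ioi (0:ℝ), HasDerivAt (fun x =>
      x * (besselI 0 x * besselK 1 x + besselI 1 x * besselK 0 x)) 0 x := by
    intro x hx
    have hx : 0 < x := hx
    have hI1 : besselI (-1) x = besselI 1 x := by simp [besselI]
    have hK1 : besselK (-1) x = besselK 1 x := by simp [besselK]
    have a0 := bI_deriv 0 x
    have a1 := bI_deriv 1 x
    have b0 := bK_deriv 0 hx
    have b1 := bK_deriv 1 hx
    have rI := bI_rec 1 x
    have rK := bK_rec 1 hx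
    norm_num at a0 a1 b0 b1 rI rK
    rw [hI1] at a0
    rw [hK1] at b0
    refine ((hasDerivAt_id x).mul ((a0.mul b1).add (a1.mul b0))).congr_deriv ?_
    simp only [id]
    simp only [Pi.mul_apply, Pi.add_apply]
    linear_combination -(1 / 2 * besselI 0 x) * rK - (1 / 2 * besselK 0 x) * rI
  exact isOpen_Ioi.is_const_of_deriv_eq_zero (convex_Ioi (0:ℝ)).isPreconnected
    (fun x hx => (hd x hx).differentiableAt.differentiableWithinAt)
    (fun x hx => (hd x hx).deriv) hs ht

lemma bW_le {t : ℝ} (ht : 0 < t) :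
    t * (besselI 0 t * besselK 1 t + besselI 1 t * besselK 0 t) ≤ 1 := by
  have c0 := (bI_deriv 0 0).continuousAt.tendsto
  have c1 := (bI_deriv 1 0).continuousAt.tendsto
  have e0 : besselI 0 0 = 1 := by simp [besselI]
  have e1 : besselI 1 0 = 0 := by simp [besselI]
  rw [e0] at c0
  rw [e1] at c1
  have c := (c0.add c1).mono_left (nhdsWithin_le_nhds (s := Set.Ioi (0:ℝ)))
  rw [add_zero] at c
  refine ge_of_tendsto c ?_
  filter_upwards [self_mem_nhdsWithin] with s hs
  have hs : 0 < s := hs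
  rw [bW_const ht hs]
  have h1 := bK1_le hs
  have h2 : s * besselK 0 s ≤ 1 :=
    (mul_le_mul_of_nonneg_left (bK0_le hs) hs.le).trans h1
  have h3 := mul_le_mul_of_nonneg_left h1 (bI_nonneg 0 hs)
  have h4 := mul_le_mul_of_nonneg_left h2 (bI_nonneg 1 hs)
  linarith

lemma bW_n (k : ℕ) {t : ℝ} (ht : 0 < t) :
    t * (besselI k t * besselK (k + 1) t + besselI (k + 1) t * besselK k t) ≤ 1 := by
  induction k with
  | zero => simpa using bW_le ht
  | succ k ih =>
    have rI := bI_rec (k + 1) t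
    have rK := bK_rec (k + 1) ht
    simp only [add_sub_cancel_right] at rI rK
    push_cast at *
    refine le_trans (le_of_eq ?_) ih
    linear_combination besselI (k + 1) t * rK - besselK (k + 1) t * rI

/-- `K_n(t)·I_n(t) ≤ 1/(2n)` for `n ≥ 1` and `t > 0`. -/
theorem besselK_mul_besselI_le (n : ℤ) (hn : 1 ≤ n) (t : ℝ) (ht : 0 < t) :
    besselK n t * besselI n t ≤ 1 / (2 * (n : ℝ)) := by
  have hn' : (0:ℝ) < n := by exact_mod_cast hn
  rw [le_div_iff₀ (by positivity)]
  obtain ⟨k, rfl⟩ := Int.eq_ofNat_of_zero_le (by omega : 0 ≤ n)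
  have h := bW_n k ht
  have rK := bK_rec k ht
  have h1 : 0 ≤ t * (besselI (k+1) t * besselK k t) :=
    mul_nonneg ht.le (mul_nonneg (bI_nonneg _ ht) (bK_nonneg _ _))
  have h2 : 0 ≤ t * (besselI k t * besselK (k-1) t) :=
    mul_nonneg ht.le (mul_nonneg (bI_nonneg _ ht) (bK_nonneg _ _))
  have h3 : besselK k t * besselI k t * (2 * ((k:ℤ):ℝ)) =
    t * (besselI k t * besselK (k+1) t) - t * (besselI k t * besselK (k-1) t) := by
    linear_combination -besselI k t * rK
  linarith
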